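/- (Filaseta–Schinzel) Let P(y) ∈ ℤ[y] be a nonzero polynomial with exactly N nonzero terms, let b be a positive integer with Φ_b(y) dividing P(y), and let p_1, …, p_k be distinct primes satisfying Σ_{j=1}^{k} (p_j − 2) > N − 2. For each j, let e_j be the largest exponent such that p_j^{e_j} divides b. Then there exists some j with 1 ≤ j ≤ k such that Φ_{b'}(y) divides P(y), where b' = b / p_j^{e_j}. -/

import Mathlib

open Finset Polynomial

namespace FS

/-- residue class label of `n`: digits of `n` modulo `h * p`. -/
def lab (h p n : ℕ) : ℕ × ℕ := (n % h, n / h % p)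

/-- The part of `P` supported on exponents with label `c`. -/
noncomputable def part (h p : ℕ) (c : ℕ × ℕ) (P : ℤ[X]) : ℤ[X] :=
  ∑ n ∈ P.support with lab h p n = c, monomial n (P.coeff n)

lemma coeff_part (h p : ℕ) (c : ℕ × ℕ) (P : ℤ[X]) (n : ℕ) :
    (part h p c P).coeff n = if lab h p n = c then P.coeff n else 0 := by
  unfold part
  rw [finsetSum_coeff]
  simp only [coeff_monomial]
  rw [Finset.sum_ite_eq']
  by_cases h1 : lab h p n = c <;> by_cases h2 : P.coeff n = 0 <;> simp [h1, h2]

lemma support_part (h p : ℕ) (c : ℕ × ℕ) (P : ℤ[X]) :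
    (part h p c P).support = P.support.filter (fun n => lab h p n = c) := by
  ext n
  simp only [mem_support_iff, coeff_part, Finset.mem_filter]
  by_cases h1 : lab h p n = c <;> simp [h1]

lemma aeval_part (h p : ℕ) (c : ℕ × ℕ) (P : ℤ[X]) (x : ℂ) :
    aeval x (part h p c P) = ∑ n ∈ P.support with lab h p n = c, (P.coeff n : ℂ) * x ^ n := by
  unfold part
  simp [aeval_monomial]

lemma aeval_supp (P : ℤ[X]) (x : ℂ) :
    aeval x P = ∑ n ∈ P.support, (P.coeff n : ℂ) * x ^ n := by
  rw [aeval_def, eval₂_eq_sum, Polynomial.sum_def]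
  simp

lemma lab_mem {h p : ℕ} (hh : 0 < h) (hp : 0 < p) (n : ℕ) :
    lab h p n ∈ range h ×ˢ range p := by
  simp [lab, Nat.mod_lt, hh, hp]

lemma lab_val (h p n : ℕ) : n % (h * p) = (lab h p n).1 + h * (lab h p n).2 := by
  simp [lab, Nat.mod_mul]

lemma card_parts {h p : ℕ} (hh : 0 < h) (hp : 0 < p) (P : ℤ[X]) :
    P.support.card = ∑ r ∈ range h, ∑ s ∈ range p, (part h p (r, s) P).support.card := by
  rw [← Finset.sum_product' (range h) (range p) (fun r s => (part h p (r, s) P).support.card)]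
  simp only [support_part]
  exact Finset.card_eq_sum_card_fiberwise (fun n _ => lab_mem hh hp n)

lemma aeval_twist {h p : ℕ} (hh : 0 < h) (hp : 0 < p) (P : ℤ[X]) (x θ : ℂ)
    (hθ : θ ^ (h * p) = 1) :
    aeval (θ * x) P = ∑ r ∈ range h, ∑ s ∈ range p,
      θ ^ (r + h * s) * aeval x (part h p (r, s) P) := by
  rw [← Finset.sum_product' (range h) (range p)
    (fun r s => θ ^ (r + h * s) * aeval x (part h p (r, s) P)), aeval_supp,
    ← Finset.sum_fiberwise_of_maps_to (fun n _ => lab_mem hh hp n)]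
  refine Finset.sum_congr rfl fun c _ => ?_
  rw [aeval_part, Finset.mul_sum]
  refine Finset.sum_congr rfl fun n hn => ?_
  have h1 : lab h p n = c := (Finset.mem_filter.1 hn).2
  have h2 : θ ^ n = θ ^ (c.1 + h * c.2) := by
    rw [← h1, ← lab_val]; exact pow_eq_pow_mod n hθ
  rw [mul_pow, h2]; ring

end FS
namespace FS

lemma dvd_iff {n : ℕ} (hn : 0 < n) {x : ℂ} (hx : IsPrimitiveRoot x n) (P : ℤ[X]) :
    cyclotomic n ℤ ∣ P ↔ aeval x P = 0 := by
  rw [cyclotomic_eq_minpoly hx hn]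
  exact (minpoly.isIntegrallyClosed_dvd_iff (hx.isIntegral hn) P).symm

lemma prim_mul {a b : ℕ} (hab : a.Coprime b) {x y : ℂ} (hx : IsPrimitiveRoot x a)
    (hy : IsPrimitiveRoot y b) : IsPrimitiveRoot (x * y) (a * b) := by
  rw [IsPrimitiveRoot.iff_orderOf, (Commute.all x y).orderOf_mul_eq_mul_orderOf_of_coprime,
    ← hx.eq_orderOf, ← hy.eq_orderOf]
  rwa [← hx.eq_orderOf, ← hy.eq_orderOf]

lemma ortho {q : ℕ} (hq : 0 < q) {θ : ℂ} (hθ : IsPrimitiveRoot θ q) (n t : ℕ) :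
    ∑ i ∈ range q, (θ⁻¹) ^ (i * t) * θ ^ (i * n) = if n % q = t % q then (q : ℂ) else 0 := by
  have h0 : θ ≠ 0 := hθ.ne_zero hq.ne'
  have e : ∀ i, (θ⁻¹) ^ (i * t) * θ ^ (i * n) = ((θ⁻¹) ^ t * θ ^ n) ^ i := by
    intro i; rw [mul_pow, ← pow_mul, ← pow_mul, mul_comm i t, mul_comm i n]
  simp only [e]
  have h1 : (θ⁻¹) ^ t * θ ^ n = 1 ↔ n % q = t % q := by
    rw [inv_pow, inv_mul_eq_one₀ (pow_ne_zero _ h0), eq_comm,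
      pow_eq_pow_mod n hθ.pow_eq_one, pow_eq_pow_mod t hθ.pow_eq_one]
    exact ⟨fun h => hθ.pow_inj (Nat.mod_lt _ hq) (Nat.mod_lt _ hq) h, fun h => by rw [h]⟩
  split_ifs with h
  · rw [h1.2 h]; simp
  · have hne : (θ⁻¹) ^ t * θ ^ n ≠ 1 := fun hh => h (h1.1 hh)
    rw [geom_sum_eq hne, mul_pow, ← pow_mul, ← pow_mul, mul_comm t, mul_comm n, pow_mul, pow_mul,
      inv_pow, hθ.pow_eq_one]
    simp

lemma fourier {h p : ℕ} (hh : 0 < h) (hp : 0 < p) {θ : ℂ} (hθ : IsPrimitiveRoot θ (h * p))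
    (P : ℤ[X]) (x : ℂ) (r s : ℕ) (hr : r < h) (hs : s < p) :
    ∑ i ∈ range (h * p), (θ⁻¹) ^ (i * (r + h * s)) * aeval (θ ^ i * x) P
      = (h * p : ℕ) * aeval x (part h p (r, s) P) := by
  have hq : 0 < h * p := Nat.mul_pos hh hp
  simp only [aeval_supp P, Finset.mul_sum]
  rw [Finset.sum_comm, aeval_part, Finset.mul_sum, Finset.sum_filter]
  refine Finset.sum_congr rfl fun n _ => ?_
  have e : ∀ i, (θ⁻¹) ^ (i * (r + h * s)) * ((P.coeff n : ℂ) * (θ ^ i * x) ^ n)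
      = (P.coeff n : ℂ) * x ^ n * ((θ⁻¹) ^ (i * (r + h * s)) * θ ^ (i * n)) := by
    intro i; rw [mul_pow, ← pow_mul]; ring
  simp only [e]
  rw [← Finset.mul_sum, ortho hq hθ]
  have hlt : r + h * s < h * p := by nlinarith
  have hiff : n % (h * p) = (r + h * s) % (h * p) ↔ lab h p n = (r, s) := by
    rw [Nat.mod_eq_of_lt hlt]
    constructor
    · intro e1
      rw [lab_val] at e1
      have h1 : (lab h p n).1 < h := Nat.mod_lt _ hh
      have e2 : (lab h p n).1 = r := by
        have := congrArg (· % h) e1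
        simpa [Nat.add_mul_mod_self_left, Nat.mod_eq_of_lt h1, Nat.mod_eq_of_lt hr] using this
      refine Prod.ext e2 ?_
      have : h * (lab h p n).2 = h * s := by omega
      exact Nat.eq_of_mul_eq_mul_left hh this
    · intro e1
      rw [lab_val, e1]
  by_cases hc : lab h p n = (r, s)
  · rw [if_pos (hiff.2 hc), if_pos hc]; ring
  · rw [if_neg (fun z => hc (hiff.1 z)), if_neg hc]; ring

/-- forward direction: equal values on a class -/
lemma key_fwd {p e m : ℕ} (hp : p.Prime) (hm : 0 < m) (hpm : p.Coprime m) {x : ℂ}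
    (hx : IsPrimitiveRoot x m) (P : ℤ[X]) (hd : cyclotomic (p ^ e * p * m) ℤ ∣ P)
    {r s s' : ℕ} (hr : r < p ^ e) (hs : s < p) (hs' : s' < p) :
    aeval x (part (p ^ e) p (r, s) P) = aeval x (part (p ^ e) p (r, s') P) := by
  have hh : 0 < p ^ e := pow_pos hp.pos e
  have hq : 0 < p ^ e * p := Nat.mul_pos hh hp.pos
  obtain ⟨θ, hθ⟩ : ∃ θ : ℂ, IsPrimitiveRoot θ (p ^ e * p) :=
    ⟨_, Complex.isPrimitiveRoot_exp _ hq.ne'⟩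
  have h0 : ((p ^ e * p : ℕ) : ℂ) ≠ 0 := by exact_mod_cast hq.ne'
  refine mul_left_cancel₀ h0 ?_
  rw [← fourier hh hp.pos hθ P x r s hr hs, ← fourier hh hp.pos hθ P x r s' hr hs']
  refine Finset.sum_congr rfl fun i _ => ?_
  by_cases hi : p ∣ i
  · obtain ⟨j, rfl⟩ := hi
    congr 1
    have key : ∀ u, (θ⁻¹) ^ (p * j * (r + p ^ e * u)) = (θ⁻¹) ^ (p * j * r) := by
      intro u
      have : p * j * (r + p ^ e * u) = p * j * r + (p ^ e * p) * (j * u) := by ring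
      rw [this, pow_add, pow_mul _ (p ^ e * p), inv_pow _ (p ^ e * p), hθ.pow_eq_one]
      simp
    rw [key, key]
  · have hc : i.Coprime (p ^ e * p) := by
      rw [← pow_succ]
      exact Nat.Coprime.pow_right _ ((Nat.Prime.coprime_iff_not_dvd hp).2 hi).symm
    have hpr := prim_mul (by rw [← pow_succ]; exact Nat.Coprime.pow_left _ hpm)
      (hθ.pow_of_coprime i hc) hx
    rw [(dvd_iff (Nat.mul_pos hq hm) hpr P).1 hd]
    simp

lemma key_bwd {p e m : ℕ} (hp : p.Prime) (hm : 0 < m) (hpm : p.Coprime m) {x : ℂ}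
    (hx : IsPrimitiveRoot x m) (P : ℤ[X])
    (H : ∀ r < p ^ e, ∀ s < p,
      aeval x (part (p ^ e) p (r, s) P) = aeval x (part (p ^ e) p (r, 0) P)) :
    cyclotomic (p ^ e * p * m) ℤ ∣ P := by
  have hh : 0 < p ^ e := pow_pos hp.pos e
  have hq : 0 < p ^ e * p := Nat.mul_pos hh hp.pos
  obtain ⟨θ, hθ⟩ : ∃ θ : ℂ, IsPrimitiveRoot θ (p ^ e * p) :=
    ⟨_, Complex.isPrimitiveRoot_exp _ hq.ne'⟩
  have hpr := prim_mul (by rw [← pow_succ]; exact Nat.Coprime.pow_left _ hpm) hθ hx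
  rw [dvd_iff (Nat.mul_pos hq hm) hpr P, aeval_twist hh hp.pos P x θ hθ.pow_eq_one]
  refine Finset.sum_eq_zero fun r hr => ?_
  have hz := (hθ.pow hq rfl).geom_sum_eq_zero hp.one_lt
  calc _ = ∑ s ∈ range p, (θ ^ r * aeval x (part (p ^ e) p (r, 0) P)) * (θ ^ p ^ e) ^ s := by
        refine Finset.sum_congr rfl fun s hs => ?_
        rw [H r (mem_range.1 hr) s (mem_range.1 hs), pow_add, pow_mul]; ring
    _ = 0 := by rw [← Finset.mul_sum, hz, mul_zero]

/-- pairs with different values -/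
lemma pairs {p : ℕ} (f : ℕ → ℂ) {a b : ℕ} (ha : a < p) (hb : b < p) (hab : f a ≠ f b) :
    2 * (p - 1) ≤ ((range p).offDiag.filter (fun c => f c.1 ≠ f c.2)).card := by
  classical
  set C := (range p).filter (fun i => f i = f a)
  set D := (range p).filter (fun i => f i ≠ f a)
  have hcd : C.card + D.card = p := by
    have := Finset.card_filter_add_card_filter_not (s := range p) (fun i => f i = f a)
    simpa [C, D] using this
  have hC : 0 < C.card := Finset.card_pos.2 ⟨a, by simp [C, ha]⟩
  have hD : 0 < D.card := Finset.card_pos.2 ⟨b, by simp [D, hb, hab.symm]⟩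
  have hsub : C ×ˢ D ∪ D ×ˢ C ⊆ (range p).offDiag.filter (fun c => f c.1 ≠ f c.2) := by
    rintro ⟨u, v⟩ h
    simp only [C, D, mem_union, mem_product, mem_filter, mem_range, mem_offDiag] at h ⊢
    rcases h with ⟨⟨h1, h2⟩, h3, h4⟩ | ⟨⟨h3, h4⟩, h1, h2⟩
    · have : f u ≠ f v := by rw [h2]; exact h4.symm
      exact ⟨⟨h1, h3, fun e => this (by rw [e])⟩, this⟩
    · have : f u ≠ f v := by rw [h2]; exact h4
      exact ⟨⟨h3, h1, fun e => this (by rw [e])⟩, this⟩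
  have hdisj : Disjoint (C ×ˢ D) (D ×ˢ C) := by
    rw [Finset.disjoint_left]
    rintro ⟨u, v⟩ h h'
    simp only [C, D, mem_product, mem_filter] at h h'
    exact h'.1.2 h.1.2
  have := Finset.card_le_card hsub
  rw [Finset.card_union_of_disjoint hdisj, card_product, card_product] at this
  obtain ⟨u, hu⟩ := Nat.exists_eq_add_of_lt hC
  obtain ⟨v, hv⟩ := Nat.exists_eq_add_of_lt hD
  rw [hu, hv] at this hcd
  have : p - 1 = u + v + 1 := by omega
  nlinarith [Nat.zero_le (u * v)]

lemma sum_offDiag (p : ℕ) (N : ℕ → ℕ) :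
    ∑ c ∈ (range p).offDiag, (N c.1 + N c.2) = 2 * (p - 1) * ∑ s ∈ range p, N s := by
  have h1 : ∑ c ∈ (range p).offDiag, (N c.1 + N c.2) + ∑ c ∈ (range p).diag, (N c.1 + N c.2)
      = ∑ c ∈ range p ×ˢ range p, (N c.1 + N c.2) := by
    rw [← Finset.diag_union_offDiag, Finset.sum_union (Finset.disjoint_diag_offDiag _), add_comm]
  have h2 : ∑ c ∈ (range p).diag, (N c.1 + N c.2) = 2 * ∑ s ∈ range p, N s := by
    rw [Finset.sum_diag, Finset.mul_sum]
    exact Finset.sum_congr rfl fun _ _ => by ring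
  have h3 : ∑ c ∈ range p ×ˢ range p, (N c.1 + N c.2) = 2 * p * ∑ s ∈ range p, N s := by
    rw [Finset.sum_product]
    simp only [Finset.sum_add_distrib, Finset.sum_const, card_range, smul_eq_mul, ← Finset.mul_sum]
    ring
  rcases p with _ | p
  · simp
  · rw [h2, h3] at h1
    simp only [Nat.add_sub_cancel]
    nlinarith

end FS
namespace FS

/-- `b` with its `p`-part removed. -/
abbrev oc (p b : ℕ) : ℕ := b / p ^ b.factorization p

lemma oc_comm (b p l : ℕ) (hb : 0 < b) (hp : p.Prime) (hl : l.Prime) (hpl : p ≠ l) :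
    oc l b = p ^ b.factorization p * oc l (oc p b) := by
  have h1 : b = p ^ b.factorization p * oc p b := (Nat.ordProj_mul_ordCompl_eq_self b p).symm
  conv_lhs => rw [h1]
  unfold oc
  rw [Nat.ordCompl_mul]
  congr 1
  have : (p ^ b.factorization p).factorization l = 0 := by
    rw [hp.factorization_pow]; simp [hpl]
  rw [this]; simp

lemma two_le {P : ℤ[X]} (hP : P ≠ 0) {b : ℕ} (hb : 0 < b) (hd : cyclotomic b ℤ ∣ P) :
    2 ≤ P.support.card := by
  by_contra hlt
  have h0 : P.support.card ≠ 0 := by simpa using hP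
  have h1 : P.support.card = 1 := by omega
  obtain ⟨n, hn⟩ := Finset.card_eq_one.1 h1
  have hx := Complex.isPrimitiveRoot_exp b hb.ne'
  have h2 := (dvd_iff hb hx P).1 hd
  rw [aeval_supp, hn, Finset.sum_singleton] at h2
  have h3 : P.coeff n ≠ 0 := by rw [← mem_support_iff, hn]; simp
  rcases mul_eq_zero.1 h2 with h | h
  · exact h3 (by exact_mod_cast h)
  · exact pow_ne_zero _ (hx.ne_zero hb.ne') h

open Classical in
lemma main (S : Finset ℕ) : (∀ l ∈ S, l.Prime) → ∀ (P : ℤ[X]) (b : ℕ), P ≠ 0 → 0 < b →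
    cyclotomic b ℤ ∣ P →
    2 + ∑ l ∈ S, (if cyclotomic (oc l b) ℤ ∣ P then 0 else l - 2) ≤ P.support.card := by
  induction S using Finset.induction_on with
  | empty => intro _ P b hP hb hd; simpa using two_le hP hb hd
  | insert p S hpS ih =>
    intro hS P b hP hb hd
    have hp : p.Prime := hS p (by simp)
    have hS' : ∀ l ∈ S, l.Prime := fun l hl => hS l (by simp [hl])
    rw [Finset.sum_insert hpS]
    by_cases hbad : cyclotomic (oc p b) ℤ ∣ P
    · rw [if_pos hbad, zero_add]; exact ih hS' P b hP hb hd
    rw [if_neg hbad]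
    -- set-up
    obtain ⟨e, he⟩ : ∃ e, b.factorization p = e + 1 := by
      rcases hv : b.factorization p with _ | e
      · exact absurd (by simpa [oc, hv] using hd) hbad
      · exact ⟨e, rfl⟩
    set m := oc p b with hm_def
    have hbm : b = p ^ e * p * m := by
      rw [← pow_succ, ← he]; exact (Nat.ordProj_mul_ordCompl_eq_self b p).symm
    have hm : 0 < m := Nat.ordCompl_pos p hb.ne'
    have hpm : p.Coprime m := Nat.coprime_ordCompl hp hb.ne'
    have hh : 0 < p ^ e := pow_pos hp.pos e
    have hx := Complex.isPrimitiveRoot_exp m hm.ne'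
    set x := Complex.exp (2 * Real.pi * Complex.I / m) with hx_def
    have hfwd : ∀ {r s s' : ℕ}, r < p ^ e → s < p → s' < p →
        aeval x (part (p ^ e) p (r, s) P) = aeval x (part (p ^ e) p (r, s') P) :=
      fun hr hs hs' => key_fwd hp hm hpm hx P (hbm ▸ hd) hr hs hs'
    obtain ⟨r0, hr0, hne0⟩ : ∃ r0 < p ^ e, ∀ s < p, part (p ^ e) p (r0, s) P ≠ 0 := by
      rw [dvd_iff hm hx] at hbad
      have h1 := aeval_twist hh hp.pos P x 1 (one_pow _)
      rw [one_mul] at h1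
      rw [h1] at hbad
      obtain ⟨r, hr, h2⟩ := Finset.exists_ne_zero_of_sum_ne_zero hbad
      obtain ⟨s, hs, h3⟩ := Finset.exists_ne_zero_of_sum_ne_zero h2
      rw [one_pow, one_mul] at h3
      refine ⟨r, mem_range.1 hr, fun s' hs' hz => h3 ?_⟩
      rw [hfwd (mem_range.1 hr) (mem_range.1 hs) hs', hz, map_zero]
    -- primitive roots for the other primes
    let z : ℕ → ℂ := fun l => Complex.exp (2 * Real.pi * Complex.I / (oc l m : ℕ))
    have hz : ∀ l, IsPrimitiveRoot (z l) (oc l m) := fun l =>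
      Complex.isPrimitiveRoot_exp _ (Nat.ordCompl_pos l hm.ne').ne'
    let f : ℕ → ℕ → ℕ → ℂ := fun l r s => aeval (z l) (part (p ^ e) p (r, s) P)
    let N : ℕ → ℕ → ℕ := fun r s => (part (p ^ e) p (r, s) P).support.card
    -- pair inequality
    have hpair : ∀ r < p ^ e, ∀ c ∈ (range p).offDiag,
        (if r = r0 then 2 else 0) + ∑ l ∈ S, (if f l r c.1 = f l r c.2 then 0 else l - 2)
          ≤ N r c.1 + N r c.2 := by
      rintro r hr ⟨s, s'⟩ hc
      simp only [mem_offDiag, mem_range] at hc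
      obtain ⟨hs, hs', hss⟩ := hc
      set D := part (p ^ e) p (r, s) P - part (p ^ e) p (r, s') P with hD
      have hcard : D.support.card ≤ N r s + N r s' := by
        refine le_trans (Finset.card_le_card (t := (part (p ^ e) p (r, s) P).support ∪
          (part (p ^ e) p (r, s') P).support) ?_) (Finset.card_union_le _ _)
        intro n hn
        simp only [mem_union, mem_support_iff, hD, coeff_sub] at hn ⊢
        by_contra hcon
        push Not at hcon
        rw [hcon.1, hcon.2] at hn
        simp at hn
      have hff : ∀ l, (f l r s = f l r s' ↔ cyclotomic (oc l m) ℤ ∣ D) := by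
        intro l
        rw [dvd_iff (Nat.ordCompl_pos l hm.ne') (hz l), hD, map_sub, sub_eq_zero]
      simp only [hff]
      by_cases hD0 : D = 0
      · have hrr : r ≠ r0 := by
          rintro rfl
          apply hne0 s hs
          ext n
          have h1 := congrArg (fun Q => coeff Q n) hD0
          simp only [hD, coeff_sub, coeff_part, coeff_zero] at h1 ⊢
          by_cases h2 : lab (p ^ e) p n = (r, s)
          · have h3 : ¬ lab (p ^ e) p n = (r, s') := by rw [h2]; simpa using hss
            rwa [if_neg h3, sub_zero] at h1
          · rw [if_neg h2]
        simp [hrr, hD0]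
      · have hdv : cyclotomic m ℤ ∣ D := by
          rw [dvd_iff hm hx, hD, map_sub, sub_eq_zero]
          exact hfwd hr hs hs'
        have := ih hS' D m hD0 hm hdv
        have h2 : (if r = r0 then 2 else 0) ≤ 2 := by split_ifs <;> simp
        show (if r = r0 then 2 else 0) + _ ≤ N r s + N r s'
        omega
    -- each bad prime is separated
    have hsep : ∀ l ∈ S, (if cyclotomic (oc l b) ℤ ∣ P then 0 else l - 2) * (2 * (p - 1)) ≤
        ∑ r ∈ range (p ^ e), ∑ c ∈ (range p).offDiag,
          (if f l r c.1 = f l r c.2 then 0 else l - 2) := by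
      intro l hl
      split_ifs with hbl
      · simp
      have hlp : p ≠ l := by rintro rfl; exact hpS hl
      have hex : ∃ r < p ^ e, ∃ s < p, f l r s ≠ f l r 0 := by
        by_contra hcon
        push Not at hcon
        apply hbl
        rw [oc_comm b p l hb hp (hS' l hl) hlp, he, pow_succ]
        refine key_bwd hp (Nat.ordCompl_pos l hm.ne') ?_ (hz l) P hcon
        exact Nat.Coprime.coprime_dvd_right (Nat.ordCompl_dvd m l) hpm
      obtain ⟨r, hr, s, hs, hne⟩ := hex
      refine le_trans ?_ (Finset.single_le_sum (f := fun r => ∑ c ∈ (range p).offDiag,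
          (if f l r c.1 = f l r c.2 then 0 else l - 2)) (fun _ _ => Nat.zero_le _)
          (mem_range.2 hr))
      have h1 := pairs (f l r) hs hp.pos hne
      have h2 : ∑ c ∈ (range p).offDiag, (if f l r c.1 = f l r c.2 then 0 else l - 2)
          = ((range p).offDiag.filter (fun c => f l r c.1 ≠ f l r c.2)).card * (l - 2) := by
        rw [← smul_eq_mul, ← Finset.sum_const, Finset.sum_filter]
        refine Finset.sum_congr rfl fun c _ => ?_
        by_cases h : f l r c.1 = f l r c.2 <;> simp [h]
      simp only [h2]
      rw [mul_comm]
      exact Nat.mul_le_mul_right _ h1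
    -- total
    have htot : 2 * (p - 1) * P.support.card =
        ∑ r ∈ range (p ^ e), ∑ c ∈ (range p).offDiag, (N r c.1 + N r c.2) := by
      rw [card_parts hh hp.pos P, Finset.mul_sum]
      exact Finset.sum_congr rfl fun r _ => (sum_offDiag p (N r)).symm
    have hA : ∑ r ∈ range (p ^ e), ∑ c ∈ (range p).offDiag, (if r = r0 then 2 else 0)
        = 2 * (p - 1) * p := by
      rw [Finset.sum_eq_single_of_mem r0 (mem_range.2 hr0) (by intro r _ h; simp [h])]
      have h1 := hp.pos
      simp only [if_true, Finset.sum_const, offDiag_card, card_range, smul_eq_mul]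
      obtain ⟨u, rfl⟩ : ∃ u, p = u + 1 := ⟨p - 1, by omega⟩
      have : (u + 1) * (u + 1) - (u + 1) = u * (u + 1) := by
        rw [Nat.sub_eq_iff_eq_add (by nlinarith)]; ring
      rw [this, Nat.add_sub_cancel]; ring
    have hB : (∑ l ∈ S, (if cyclotomic (oc l b) ℤ ∣ P then 0 else l - 2)) * (2 * (p - 1)) ≤
        ∑ r ∈ range (p ^ e), ∑ c ∈ (range p).offDiag, ∑ l ∈ S,
          (if f l r c.1 = f l r c.2 then 0 else l - 2) := by
      rw [Finset.sum_mul]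
      refine (Finset.sum_le_sum hsep).trans (le_of_eq ?_)
      rw [Finset.sum_comm]
      exact Finset.sum_congr rfl fun r _ => Finset.sum_comm
    have hC := Finset.sum_le_sum fun r (hr : r ∈ range (p ^ e)) =>
      Finset.sum_le_sum (hpair r (mem_range.1 hr))
    simp only [Finset.sum_add_distrib] at hC htot
    rw [← htot, hA] at hC
    have h2 := hp.two_le
    have hpos : 0 < 2 * (p - 1) := by omega
    have hfin : p + ∑ l ∈ S, (if cyclotomic (oc l b) ℤ ∣ P then 0 else l - 2)
        ≤ P.support.card := by
      refine Nat.le_of_mul_le_mul_left ?_ hpos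
      rw [mul_add, mul_comm (2 * (p - 1)) (∑ l ∈ S, _)]
      exact (Nat.add_le_add_left hB _).trans hC
    omega

end FS

/-- **Filaseta–Schinzel.** Let `P ∈ ℤ[y]` be nonzero with exactly `N`
nonzero terms, let `Φ_b ∣ P` for a positive integer `b`, and let `p_1, …, p_k` be
distinct primes with `∑ (p_j − 2) > N − 2`. Then for some `j`, `Φ_{b'} ∣ P` where
`b' = b / p_j^{e_j}` and `e_j` is the largest exponent with `p_j^{e_j} ∣ b`. -/
theorem filaseta_schinzel
    (P : Polynomial ℤ) (hP : P ≠ 0) (b : ℕ) (hb : 0 < b)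
    (hdvd : Polynomial.cyclotomic b ℤ ∣ P)
    (k : ℕ) (p : Fin k → ℕ) (hprime : ∀ j, (p j).Prime)
    (hinj : Function.Injective p)
    (hsum : (P.support.card : ℤ) - 2 < ∑ j : Fin k, ((p j : ℤ) - 2)) :
    ∃ j : Fin k,
      Polynomial.cyclotomic (b / (p j) ^ (b.factorization (p j))) ℤ ∣ P := by
  classical
  by_contra hcon
  push Not at hcon
  have h := FS.main (Finset.univ.image p) (by simpa using hprime) P b hP hb hdvd
  rw [Finset.sum_image (fun a _ c _ hac => hinj hac)] at h
  have h' : 2 + ∑ j : Fin k, (p j - 2) ≤ P.support.card := by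
    convert h using 3 with j
    exact (if_neg (hcon j)).symm
  have h2 : ((∑ j : Fin k, (p j - 2) : ℕ) : ℤ) = ∑ j : Fin k, ((p j : ℤ) - 2) := by
    rw [Nat.cast_sum]
    exact Finset.sum_congr rfl fun j _ => by rw [Nat.cast_sub (hprime j).two_le]; rfl
  rw [← h2] at hsum
  omega
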